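/- Let n, m be integers with m ≥ 2 and n > 2m, and let s > m. Then there exists a constant C = C(s, m, n) such that for every z ∈ ℂ \ [0, ∞) and every Schwartz function u on ℝⁿ, ‖⟨x⟩^{−s} u‖_{L²(ℝⁿ)} ≤ C ‖⟨x⟩^{s} ((−Δ)^m u − z u)‖_{L²(ℝⁿ)}. (Equivalently, the resolvent R₀(z) = ((−Δ)^m − z)^{-1} satisfies sup_{z ∈ ℂ \ [0,∞)} ‖R₀(z)‖_{L²_s → L²_{−s}} < ∞, where L²_s is the weighted space with norm ‖⟨x⟩^s f‖_{L²}.) -/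

import Mathlib

open MeasureTheory Complex Real
open scoped ENNReal

noncomputable section

/-- Euclidean space `ℝⁿ`. -/
abbrev Euc (n : ℕ) := EuclideanSpace ℝ (Fin n)

/-- The negative Laplacian `-Δ` acting on complex-valued functions on `ℝⁿ`. -/
def negLap {n : ℕ} (u : Euc n → ℂ) : Euc n → ℂ := fun x =>
  -∑ i : Fin n, iteratedFDeriv ℝ 2 u x ![EuclideanSpace.single i 1, EuclideanSpace.single i 1]

open Set Filter Topology
open scoped SchwartzMap ComplexConjugate

lemma sz_hasDeriv (g : 𝓢(ℝ, ℂ)) (r : ℝ) : HasDerivAt g (SchwartzMap.derivCLM ℝ ℂ g r) r := by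
  have := (g.differentiable r).hasDerivAt
  simpa using this

lemma sz_int (k : ℕ) (a b : 𝓢(ℝ, ℂ)) : Integrable (fun r : ℝ => r ^ k * (‖a r‖ * ‖b r‖)) := by
  obtain ⟨C, hC⟩ := b.decay 0 0
  have h1 := a.integrable_pow_mul volume k
  refine (h1.mul_const C).mono' (by fun_prop) (Eventually.of_forall fun r => ?_)
  have := hC.2 r
  simp at this
  rw [norm_mul, norm_pow, norm_mul, norm_norm, norm_norm, ← mul_assoc]
  gcongr

lemma sz_intc (k : ℕ) (a b : 𝓢(ℝ, ℂ)) :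
    Integrable (fun r : ℝ => ((r ^ k : ℝ) : ℂ) * (a r * conj (b r))) := by
  refine (sz_int k a b).norm.mono' (by fun_prop) (Eventually.of_forall fun r => ?_)
  simp

/-- derivative of `r^(k+1) a b̄` -/
lemma sz_prod_deriv (k : ℕ) (a b : 𝓢(ℝ, ℂ)) (r : ℝ) :
    HasDerivAt (fun r : ℝ => ((r ^ (k+1) : ℝ) : ℂ) * (a r * conj (b r)))
      ((((k + 1 : ℕ) : ℝ) * r ^ k : ℝ) * (a r * conj (b r)) +
        ((r ^ (k+1) : ℝ) : ℂ) * (SchwartzMap.derivCLM ℝ ℂ a r * conj (b r)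
          + a r * conj (SchwartzMap.derivCLM ℝ ℂ b r))) r := by
  have h1 : HasDerivAt (fun r : ℝ => ((r ^ (k+1) : ℝ) : ℂ)) (((k + 1 : ℕ) : ℝ) * r ^ k : ℝ) r := by
    have := (hasDerivAt_pow (k+1) r).ofReal_comp
    simpa using this
  have hb : HasDerivAt (fun r => conj (b r)) (conj (SchwartzMap.derivCLM ℝ ℂ b r)) r :=
    (sz_hasDeriv b r).star
  exact h1.mul ((sz_hasDeriv a r).mul hb)

lemma sz_prod_deriv_int (k : ℕ) (a b : 𝓢(ℝ, ℂ)) :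
    Integrable (fun r : ℝ => ((((k + 1 : ℕ) : ℝ) * r ^ k : ℝ) : ℂ) * (a r * conj (b r)) +
        ((r ^ (k+1) : ℝ) : ℂ) * (SchwartzMap.derivCLM ℝ ℂ a r * conj (b r)
          + a r * conj (SchwartzMap.derivCLM ℝ ℂ b r))) := by
  have h1 := (sz_intc k a b).const_mul ((k + 1 : ℕ) : ℂ)
  have h2 := sz_intc (k+1) (SchwartzMap.derivCLM ℝ ℂ a) b
  have h3 := sz_intc (k+1) a (SchwartzMap.derivCLM ℝ ℂ b)
  refine (h1.add (h2.add h3)).congr (Eventually.of_forall fun r => ?_)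
  simp only [Pi.add_apply]
  push_cast
  ring

/-- the scale-invariant radial energy -/
def En (q : ℕ) (g : 𝓢(ℝ, ℂ)) : ℝ :=
  (∫ r in Ioi (0:ℝ), r ^ q * ‖g r‖ ^ 2) +
    ∫ r in Ioi (0:ℝ), r ^ (q + 2) * ‖SchwartzMap.derivCLM ℝ ℂ g r‖ ^ 2

lemma sz_int2 (k : ℕ) (a : 𝓢(ℝ, ℂ)) : Integrable (fun r : ℝ => r ^ k * ‖a r‖ ^ 2) := by
  simpa [sq] using sz_int k a a

lemma sz_deriv_bound (k : ℕ) (a b : 𝓢(ℝ, ℂ)) {r : ℝ} (hr : 0 < r) :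
    ‖(((((k + 1 : ℕ) : ℝ) * r ^ k : ℝ) : ℂ) * (a r * conj (b r)) +
        ((r ^ (k+1) : ℝ) : ℂ) * (SchwartzMap.derivCLM ℝ ℂ a r * conj (b r)
          + a r * conj (SchwartzMap.derivCLM ℝ ℂ b r)))‖ ≤
     (k + 1) * r ^ k * (‖a r‖ * ‖b r‖) + r ^ (k+1) *
      (‖SchwartzMap.derivCLM ℝ ℂ a r‖ * ‖b r‖ + ‖a r‖ * ‖SchwartzMap.derivCLM ℝ ℂ b r‖) := by
  refine (norm_add_le _ _).trans (add_le_add ?_ ?_)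
  · rw [norm_mul, norm_mul, RCLike.norm_conj, Complex.norm_real, Real.norm_of_nonneg (by positivity)]
    push_cast
    rfl
  · rw [norm_mul, Complex.norm_real, Real.norm_of_nonneg (by positivity)]
    gcongr
    refine (norm_add_le _ _).trans ?_
    simp

lemma sz_sup (q : ℕ) (g : 𝓢(ℝ, ℂ)) {r : ℝ} (hr : 0 < r) :
    r ^ (q + 1) * ‖g r‖ ^ 2 ≤ (q + 2) * En q g := by
  have hi := sz_prod_deriv_int q g g
  have hF := intervalIntegral.integral_eq_sub_of_hasDerivAt (a := 0) (b := r)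
    (fun x _ => sz_prod_deriv q g g x) hi.intervalIntegrable
  simp only [ne_eq, Nat.add_eq_zero_iff, one_ne_zero, and_false, not_false_eq_true, zero_pow,
    ofReal_zero, zero_mul, sub_zero] at hF
  have h1 : r ^ (q + 1) * ‖g r‖ ^ 2 = ‖((r ^ (q+1) : ℝ) : ℂ) * (g r * conj (g r))‖ := by
    rw [norm_mul, norm_mul, RCLike.norm_conj, Complex.norm_real,
      Real.norm_of_nonneg (by positivity), sq]
  have i1 := (sz_int2 q g).const_mul ((q:ℝ) + 2)
  have i2 := (sz_int2 (q+2) (SchwartzMap.derivCLM ℝ ℂ g))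
  rw [h1, ← hF, intervalIntegral.integral_of_le hr.le]
  calc _ ≤ ∫ x in Ioc 0 r, (((q:ℝ) + 2) * (x ^ q * ‖g x‖ ^ 2) +
            x ^ (q+2) * ‖SchwartzMap.derivCLM ℝ ℂ g x‖ ^ 2) := by
        refine norm_integral_le_of_norm_le (i1.add i2).integrableOn ?_
        refine (ae_restrict_iff' measurableSet_Ioc).2 (Eventually.of_forall fun x hx => ?_)
        refine (sz_deriv_bound q g g hx.1).trans ?_
        have := mul_nonneg (pow_nonneg hx.1.le q)
          (sq_nonneg (‖g x‖ - x * ‖SchwartzMap.derivCLM ℝ ℂ g x‖))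
        ring_nf at this ⊢
        linarith
    _ ≤ ∫ x in Ioi 0, (((q:ℝ) + 2) * (x ^ q * ‖g x‖ ^ 2) +
            x ^ (q+2) * ‖SchwartzMap.derivCLM ℝ ℂ g x‖ ^ 2) := by
        refine setIntegral_mono_set (i1.add i2).integrableOn ?_ (Ioc_subset_Ioi_self.eventuallyLE)
        refine (ae_restrict_iff' measurableSet_Ioi).2 (Eventually.of_forall fun x hx => ?_)
        have hx : 0 < x := hx
        simp only [Pi.zero_apply]
        positivity
    _ ≤ _ := by
        rw [integral_add i1.integrableOn i2.integrableOn, integral_const_mul, En, mul_add]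
        gcongr
        refine le_mul_of_one_le_left ?_ (by linarith [(Nat.cast_nonneg q : (0:ℝ) ≤ q)])
        refine setIntegral_nonneg measurableSet_Ioi fun x hx => ?_
        have hx : 0 < x := hx
        positivity

lemma sz_hardy (q : ℕ) (g : 𝓢(ℝ, ℂ)) :
    (∫ r in Ioi (0:ℝ), r ^ q * ‖g r‖ ^ 2) ≤
      4 * ∫ r in Ioi (0:ℝ), r ^ (q + 2) * ‖SchwartzMap.derivCLM ℝ ℂ g r‖ ^ 2 := by
  set D := SchwartzMap.derivCLM ℝ ℂ g with hD
  have hi := sz_prod_deriv_int q g g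
  have hlim := tendsto_zero_of_hasDerivAt_of_integrableOn_Ioi (a := 0)
    (fun x _ => sz_prod_deriv q g g x) hi.integrableOn (sz_intc (q+1) g g).integrableOn
  have hF := integral_Ioi_of_hasDerivAt_of_tendsto' (a := 0)
    (fun x _ => sz_prod_deriv q g g x) hi.integrableOn hlim
  simp only [ne_eq, Nat.add_eq_zero_iff, one_ne_zero, and_false, not_false_eq_true, zero_pow,
    ofReal_zero, zero_mul, sub_zero] at hF
  have i1 := sz_int2 q g
  have i2 := sz_int2 (q+2) D
  have j1 := (sz_intc q g g).const_mul ((q + 1 : ℕ) : ℂ)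
  have j2 := sz_intc (q+1) D g
  have j3 := sz_intc (q+1) g D
  have j23 : Integrable (fun x : ℝ => ((x ^ (q+1) : ℝ) : ℂ) * (D x * conj (g x)) +
        ((x ^ (q+1) : ℝ) : ℂ) * (g x * conj (D x))) := j2.add j3
  have e : ((q + 1 : ℕ) : ℂ) * ∫ x in Ioi (0:ℝ), ((x ^ q : ℝ) : ℂ) * (g x * conj (g x)) =
      - ∫ x in Ioi (0:ℝ), (((x ^ (q+1) : ℝ) : ℂ) * (D x * conj (g x)) +
        ((x ^ (q+1) : ℝ) : ℂ) * (g x * conj (D x))) := by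
    rw [eq_neg_iff_add_eq_zero, ← integral_const_mul, ← integral_add j1.integrableOn
      j23.integrableOn, ← hF]
    refine integral_congr_ae (Eventually.of_forall fun x => ?_)
    simp only [hD]
    push_cast
    ring
  have e2 : (∫ x in Ioi (0:ℝ), ((x ^ q : ℝ) : ℂ) * (g x * conj (g x))) =
      ((∫ r in Ioi (0:ℝ), r ^ q * ‖g r‖ ^ 2 : ℝ) : ℂ) := by
    rw [← integral_complex_ofReal]
    refine integral_congr_ae (Eventually.of_forall fun x => ?_)
    simp only
    rw [Complex.mul_conj, Complex.normSq_eq_norm_sq]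
    push_cast
    ring
  have hnn : 0 ≤ ∫ r in Ioi (0:ℝ), r ^ q * ‖g r‖ ^ 2 := by
    refine setIntegral_nonneg measurableSet_Ioi fun x hx => ?_
    have hx : 0 < x := hx
    positivity
  have hq : (0:ℝ) ≤ q := Nat.cast_nonneg q
  have key : ((q:ℝ) + 1) * (∫ r in Ioi (0:ℝ), r ^ q * ‖g r‖ ^ 2) ≤
      ∫ x in Ioi (0:ℝ), ((1/2) * (x ^ q * ‖g x‖ ^ 2) + 2 * (x ^ (q+2) * ‖D x‖ ^ 2)) := by
    have : ((q:ℝ) + 1) * (∫ r in Ioi (0:ℝ), r ^ q * ‖g r‖ ^ 2) =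
      ‖((q + 1 : ℕ) : ℂ) * ∫ x in Ioi (0:ℝ), ((x ^ q : ℝ) : ℂ) * (g x * conj (g x))‖ := by
      rw [e2, norm_mul, Complex.norm_real, Real.norm_of_nonneg hnn, Complex.norm_natCast]
      push_cast; rfl
    rw [this, e, norm_neg]
    refine norm_integral_le_of_norm_le ((i1.const_mul _).add (i2.const_mul _)).integrableOn ?_
    refine (ae_restrict_iff' measurableSet_Ioi).2 (Eventually.of_forall fun x hx => ?_)
    have hx : 0 < x := hx
    refine (norm_add_le _ _).trans ?_
    simp only [norm_mul, RCLike.norm_conj, Complex.norm_real, norm_pow,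
      Real.norm_of_nonneg hx.le]
    have := mul_nonneg (pow_nonneg hx.le q) (sq_nonneg (‖g x‖ - 2 * x * ‖D x‖))
    ring_nf at this ⊢
    linarith
  rw [integral_add (i1.const_mul _).integrableOn (i2.const_mul _).integrableOn,
    integral_const_mul, integral_const_mul] at key
  nlinarith

lemma En_nonneg (q : ℕ) (g : 𝓢(ℝ, ℂ)) : 0 ≤ En q g := by
  refine add_nonneg ?_ ?_ <;>
  · refine setIntegral_nonneg measurableSet_Ioi fun x hx => ?_
    have hx : 0 < x := hx
    positivity

lemma w_int {a : ℝ} (ha : 0 < a) : IntervalIntegrable (fun x : ℝ => |x| ^ (-1/2 : ℝ)) volume (-a) a ∧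
    ∫ x in (-a)..a, |x| ^ (-1/2 : ℝ) = 4 * √a := by
  have h1 : IntervalIntegrable (fun x : ℝ => |x| ^ (-1/2 : ℝ)) volume 0 a := by
    refine (intervalIntegral.intervalIntegrable_rpow' (a := 0) (b := a) (r := -1/2)
      (by norm_num)).congr ?_
    intro x hx
    rw [uIoc_of_le ha.le] at hx
    simp only [abs_of_pos hx.1]
  have h2 : IntervalIntegrable (fun x : ℝ => |x| ^ (-1/2 : ℝ)) volume (-a) 0 := by
    have := (IntervalIntegrable.iff_comp_neg (by simp)).1 h1.symm
    simpa using this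
  have e1 : ∫ x in (0:ℝ)..a, |x| ^ (-1/2 : ℝ) = 2 * √a := by
    have : ∫ x in (0:ℝ)..a, |x| ^ (-1/2 : ℝ) = ∫ x in (0:ℝ)..a, x ^ (-1/2 : ℝ) := by
      refine intervalIntegral.integral_congr fun x hx => ?_
      rw [uIcc_of_le ha.le] at hx
      simp only [abs_of_nonneg hx.1]
    rw [this, integral_rpow (by left; norm_num), Real.sqrt_eq_rpow]
    norm_num
    ring
  have e2 : ∫ x in (-a)..0, |x| ^ (-1/2 : ℝ) = 2 * √a := by
    rw [← e1]
    have := intervalIntegral.integral_comp_neg (a := 0) (b := a) (fun x : ℝ => |x| ^ (-1/2 : ℝ))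
    simpa using this.symm
  refine ⟨h2.trans h1, ?_⟩
  rw [← intervalIntegral.integral_add_adjacent_intervals h2 h1, e1, e2]
  ring

lemma holder_B (q : ℕ) (g h : 𝓢(ℝ, ℂ)) {l r : ℝ} (hl : 0 < l) (h1 : l / 2 ≤ r) (h2 : r ≤ 2 * l) :
    ‖((r ^ (q+1) : ℝ) : ℂ) * (g r * conj (h r)) - ((l ^ (q+1) : ℝ) : ℂ) * (g l * conj (h l))‖ ≤
      ((q + 2) * (q + 2) + 1) * (En q g + En q h) * √(|r - l| / l) := by
  rcases eq_or_ne r l with rfl | hne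
  · simp
  set E := En q g + En q h with hE
  have hE0 : 0 ≤ E := add_nonneg (En_nonneg q g) (En_nonneg q h)
  set t := √(|r - l| / l) with ht
  have hd : 0 < |r - l| := abs_pos.2 (sub_ne_zero.2 hne)
  have ht0 : 0 < t := Real.sqrt_pos.2 (by positivity)
  have ht2 : t ^ 2 = |r - l| / l := Real.sq_sqrt (by positivity)
  have ht1 : t ≤ 1 := by
    rw [ht, Real.sqrt_le_left zero_le_one, one_pow, div_le_one hl, abs_le]
    constructor <;> linarith
  set G := SchwartzMap.derivCLM ℝ ℂ g with hG
  set H := SchwartzMap.derivCLM ℝ ℂ h with hH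
  have hi := sz_prod_deriv_int q g h
  have hF := intervalIntegral.integral_eq_sub_of_hasDerivAt (a := l) (b := r)
    (fun x _ => sz_prod_deriv q g h x) hi.intervalIntegrable
  rw [← hF]
  have i1 := sz_int2 (q+2) G
  have i2 := sz_int2 (q+2) H
  set K : ℝ := ((q + 1) + t⁻¹) * (((q:ℝ) + 2) / l * E) with hK
  have i3 : Integrable (fun x : ℝ => t / 2 * (x ^ (q+2) * ‖G x‖ ^ 2 + x ^ (q+2) * ‖H x‖ ^ 2)) :=
    (i1.add i2).const_mul _
  have hsub : uIoc l r ⊆ Ioi 0 := by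
    intro x hx
    have := hx.1
    have h3 : l / 2 ≤ min l r := le_min (by linarith) h1
    exact (by linarith : 0 < x)
  have hsub2 : ∀ x ∈ uIoc l r, l / 2 ≤ x := by
    intro x hx
    have := hx.1
    have h3 : l / 2 ≤ min l r := le_min (by linarith) h1
    linarith
  have iK : IntegrableOn (fun x : ℝ => K) (uIoc l r) := by simp [uIoc]
  calc _ ≤ ∫ x in uIoc l r, (K + t / 2 * (x ^ (q+2) * ‖G x‖ ^ 2 + x ^ (q+2) * ‖H x‖ ^ 2)) := by
        rw [intervalIntegral.norm_intervalIntegral_eq]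
        refine norm_integral_le_of_norm_le (iK.add i3.integrableOn) ?_
        refine (ae_restrict_iff' measurableSet_uIoc).2 (Eventually.of_forall fun x hx => ?_)
        have hx0 : 0 < x := hsub hx
        refine (sz_deriv_bound q g h hx0).trans ?_
        have hs : x ^ q * (‖g x‖ ^ 2 + ‖h x‖ ^ 2) ≤ 2 * (((q:ℝ) + 2) / l * E) := by
          have a1 := sz_sup q g hx0
          have a2 := sz_sup q h hx0
          have : x * (x ^ q * (‖g x‖ ^ 2 + ‖h x‖ ^ 2)) ≤ (q + 2) * E := by
            rw [hE]; ring_nf at a1 a2 ⊢; linarith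
          have h4 : l / 2 * (x ^ q * (‖g x‖ ^ 2 + ‖h x‖ ^ 2)) ≤ (q + 2) * E := by
            refine le_trans ?_ this
            gcongr
            exact hsub2 x hx
          rw [show 2 * (((q:ℝ) + 2) / l * E) = ((q+2) * E) / (l/2) by field_simp,
            le_div_iff₀ (by positivity)]
          linarith
        have b1 : ((q:ℝ) + 1) * x ^ q * (‖g x‖ * ‖h x‖) ≤ (q+1) * (((q:ℝ) + 2) / l * E) := by
          have : x ^ q * (‖g x‖ * ‖h x‖) ≤ ((q:ℝ) + 2) / l * E := by
            have := mul_nonneg (pow_nonneg hx0.le q) (sq_nonneg (‖g x‖ - ‖h x‖))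
            nlinarith
          rw [mul_assoc]
          gcongr
        have b2 : ∀ a b : ℝ, x ^ (q+1) * (a * b) ≤ t / 2 * (x ^ (q+2) * a ^ 2) + t⁻¹ / 2 * (x ^ q * b ^ 2) := by
          intro a b
          have h5 := mul_nonneg (mul_nonneg (pow_nonneg hx0.le q) (inv_nonneg.2 ht0.le))
            (sq_nonneg (t * x * a - b))
          have h6 : x ^ q * t⁻¹ * (t * x * a - b) ^ 2 =
             t * (x ^ (q+2) * a ^ 2) + t⁻¹ * (x ^ q * b ^ 2) - 2 * (x ^ (q+1) * (a * b)) := by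
            field_simp
            ring
          linarith
        have b3 := b2 ‖G x‖ ‖h x‖
        have b4 := b2 ‖H x‖ ‖g x‖
        have b5 : t⁻¹ / 2 * (x ^ q * (‖g x‖ ^ 2 + ‖h x‖ ^ 2)) ≤ t⁻¹ / 2 * (2 * (((q:ℝ) + 2) / l * E)) := by
          gcongr
        rw [hK]
        ring_nf at b1 b3 b4 b5 ⊢
        linarith
    _ = |r - l| * K + ∫ x in uIoc l r, t / 2 * (x ^ (q+2) * ‖G x‖ ^ 2 + x ^ (q+2) * ‖H x‖ ^ 2) := by
        rw [integral_add iK i3.integrableOn]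
        simp [uIoc, Real.volume_real_Ioc, max_sub_min_eq_abs]
    _ ≤ |r - l| * K + ∫ x in Ioi 0, t / 2 * (x ^ (q+2) * ‖G x‖ ^ 2 + x ^ (q+2) * ‖H x‖ ^ 2) := by
        refine add_le_add le_rfl ?_
        refine setIntegral_mono_set i3.integrableOn ?_ hsub.eventuallyLE
        refine (ae_restrict_iff' measurableSet_Ioi).2 (Eventually.of_forall fun x hx => ?_)
        have hx : 0 < x := hx
        simp only [Pi.zero_apply]
        positivity
    _ ≤ |r - l| * K + t / 2 * E := by
        rw [integral_const_mul, integral_add i1.integrableOn i2.integrableOn]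
        gcongr
        rw [hE, En, En]
        have : ∀ g : 𝓢(ℝ, ℂ), 0 ≤ ∫ r in Ioi (0:ℝ), r ^ q * ‖g r‖ ^ 2 := by
          intro g
          refine setIntegral_nonneg measurableSet_Ioi fun x hx => ?_
          have hx : 0 < x := hx
          positivity
        linarith [this g, this h]
    _ ≤ _ := by
        have e1 : |r - l| = t ^ 2 * l := by rw [ht2]; field_simp
        rw [hK, e1]
        have e2 : t ^ 2 * l * (((q:ℝ) + 1 + t⁻¹) * ((q + 2) / l * E)) =
          (q+2) * E * ((q + 1) * t * t + t) := by field_simp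
        rw [e2]
        have : ((q:ℝ) + 1) * t * t ≤ (q + 1) * t * 1 := by gcongr
        have h7 : (q+2) * E * (((q:ℝ) + 1) * t * t + t) ≤ (q+2) * E * ((q+1) * t * 1 + t) := by
          gcongr
        nlinarith [mul_nonneg hE0 ht0.le]

lemma ker_lb {z : ℂ} (hz : z.im ≠ 0 ∨ z.re < 0) : ∃ d : ℝ, 0 < d ∧ ∀ x : ℝ, 0 ≤ x → d ≤ ‖(x : ℂ) - z‖ := by
  rcases hz with h | h
  · refine ⟨|z.im|, abs_pos.2 h, fun x _ => ?_⟩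
    have := Complex.abs_im_le_norm ((x:ℂ) - z)
    simpa using this
  · refine ⟨-z.re, by linarith, fun x hx => ?_⟩
    have := Complex.re_le_norm ((x:ℂ) - z)
    simp at this
    linarith

lemma ker_int (p : ℕ) {z : ℂ} (hz : z.im ≠ 0) {a b : ℝ} (ha : 0 < a) (hb : 0 < b)
    (e1 : a ^ (p+1) = z.re / 2) (e2 : b ^ (p+1) = 3 * z.re / 2) :
    IntervalIntegrable (fun r : ℝ => ((r ^ p : ℝ) : ℂ) / (((r ^ (p+1) : ℝ) : ℂ) - z)) volume a b ∧
    ‖∫ r in a..b, ((r ^ p : ℝ) : ℂ) / (((r ^ (p+1) : ℝ) : ℂ) - z)‖ ≤ π := by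
  have hne : ∀ x : ℝ, (x : ℂ) - z ≠ 0 := by
    intro x hx
    apply hz
    have := congrArg Complex.im hx
    simpa using this
  have hii : IntervalIntegrable (fun r : ℝ => ((r ^ p : ℝ) : ℂ) / (((r ^ (p+1) : ℝ) : ℂ) - z))
      volume a b := by
    apply Continuous.intervalIntegrable
    refine Continuous.div (by fun_prop) (by fun_prop) fun x => hne _
  refine ⟨hii, ?_⟩
  set u := z.re with hu
  set v := z.im with hv
  have hpos : ∀ r : ℝ, 0 < (r ^ (p+1) - u) ^ 2 + v ^ 2 := fun r => by positivity
  have hp : ((p:ℝ) + 1) ≠ 0 := by positivity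
  have hder : ∀ r : ℝ, HasDerivAt (fun r : ℝ =>
      (((1/2) * Real.log ((r ^ (p+1) - u) ^ 2 + v ^ 2) / (p + 1) : ℝ) : ℂ) +
        ((Real.arctan ((r ^ (p+1) - u) / v) / (p + 1) : ℝ) : ℂ) * I)
      (((r ^ p : ℝ) : ℂ) / (((r ^ (p+1) : ℝ) : ℂ) - z)) r := by
    intro r
    have d0 : HasDerivAt (fun r : ℝ => r ^ (p+1) - u) ((p + 1) * r ^ p) r := by
      simpa using (hasDerivAt_pow (p+1) r).sub_const u
    have d1 := (((((d0.pow 2).add_const (v^2)).log (hpos r).ne').const_mul (1/2)).div_const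
      ((p:ℝ) + 1)).ofReal_comp
    have d2 := ((((d0.div_const v).arctan).div_const ((p:ℝ)+1)).ofReal_comp).mul_const I
    refine HasDerivAt.congr_deriv (d1.add d2) ?_
    symm
    have hz' : z = u + v * I := (Complex.re_add_im z).symm
    have hr := (hpos r).ne'
    have hr' : 1 + ((r ^ (p+1) - u) / v) ^ 2 ≠ 0 := by positivity
    have hX : 1 / 2 * (((2:ℕ):ℝ) * (r ^ (p + 1) - u) ^ (2 - 1) * ((↑p + 1) * r ^ p) /
        (((fun r => r ^ (p + 1) - u) ^ 2) r + v ^ 2)) / ((p:ℝ) + 1) =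
        r ^ p * (r ^ (p+1) - u) / ((r ^ (p+1) - u) ^ 2 + v ^ 2) := by
      simp only [Pi.pow_apply, Nat.add_one_sub_one, pow_one]
      push_cast
      field_simp
    have hY : 1 / (1 + ((r ^ (p + 1) - u) / v) ^ 2) * (((p:ℝ) + 1) * r ^ p / v) / ((p:ℝ) + 1) =
        r ^ p * v / ((r ^ (p+1) - u) ^ 2 + v ^ 2) := by
      have : 1 + ((r ^ (p+1) - u) / v) ^ 2 = ((r ^ (p+1) - u) ^ 2 + v ^ 2) / v ^ 2 := by
        field_simp
        ring
      rw [this]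
      field_simp
    rw [hX, hY, div_eq_iff (hne _), hz']
    apply Complex.ext
    · simp only [Complex.mul_re, Complex.mul_im, Complex.add_re, Complex.add_im, Complex.sub_re,
        Complex.sub_im, Complex.ofReal_re, Complex.ofReal_im, Complex.I_re, Complex.I_im]
      generalize r ^ (p+1) = y at *
      field_simp
      ring
    · simp only [Complex.mul_re, Complex.mul_im, Complex.add_re, Complex.add_im, Complex.sub_re,
        Complex.sub_im, Complex.ofReal_re, Complex.ofReal_im, Complex.I_re, Complex.I_im]
      generalize r ^ (p+1) = y at *
      field_simp
      ring
  rw [intervalIntegral.integral_eq_sub_of_hasDerivAt (fun x _ => hder x) hii, e1, e2]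
  have e3 : (3 * u / 2 - u) ^ 2 = (u / 2 - u) ^ 2 := by ring
  rw [e3, add_sub_add_left_eq_sub, ← sub_mul, norm_mul, Complex.norm_I, mul_one,
    ← Complex.ofReal_sub, Complex.norm_real, ← sub_div, norm_div]
  have a1 := Real.arctan_lt_pi_div_two ((3 * u / 2 - u) / v)
  have a2 := Real.arctan_lt_pi_div_two ((u / 2 - u) / v)
  have a3 := Real.neg_pi_div_two_lt_arctan ((3 * u / 2 - u) / v)
  have a4 := Real.neg_pi_div_two_lt_arctan ((u / 2 - u) / v)
  refine (div_le_self (norm_nonneg _) ?_).trans ?_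
  · rw [Real.norm_of_nonneg (by positivity)]
    linarith [(Nat.cast_nonneg p : (0:ℝ) ≤ p)]
  · rw [Real.norm_eq_abs, abs_le]
    constructor <;> linarith

lemma ker_ptwise (p : ℕ) {z : ℂ} {l r : ℝ} (hl : 0 < l) (hr : 0 < r) (e : l ^ (p+1) = z.re) :
    ‖((r ^ p : ℝ) : ℂ) / (((r ^ (p+1) : ℝ) : ℂ) - z)‖ * |r - l| ≤ 1 := by
  have h1 : |r ^ (p+1) - l ^ (p+1)| ≤ ‖((r ^ (p+1) : ℝ) : ℂ) - z‖ := by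
    have := Complex.abs_re_le_norm (((r ^ (p+1) : ℝ) : ℂ) - z)
    rwa [Complex.sub_re, Complex.ofReal_re, ← e] at this
  have h2 : r ^ p * |r - l| ≤ |r ^ (p+1) - l ^ (p+1)| := by
    rcases le_total l r with h | h
    · have : l ^ p ≤ r ^ p := by gcongr
      rw [abs_of_nonneg (by linarith), abs_of_nonneg (by
        have : l ^ (p+1) ≤ r ^ (p+1) := by gcongr
        linarith)]
      rw [pow_succ, pow_succ]
      nlinarith
    · have : r ^ p ≤ l ^ p := by gcongr
      rw [abs_of_nonpos (by linarith), abs_of_nonpos (by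
        have : r ^ (p+1) ≤ l ^ (p+1) := by gcongr
        linarith)]
      rw [pow_succ, pow_succ]
      nlinarith
  rw [norm_div, Complex.norm_real, Real.norm_of_nonneg (by positivity), div_mul_eq_mul_div]
  exact div_le_one_of_le₀ (h2.trans h1) (norm_nonneg _)

/-- the radial uniform resolvent bound -/
lemma radial_main (p q : ℕ) : ∃ C : ℝ, 0 < C ∧ ∀ z : ℂ, (z.im ≠ 0 ∨ z.re < 0) → ∀ g h : 𝓢(ℝ, ℂ),
    ‖∫ r in Ioi (0:ℝ), (((r ^ (q+1) : ℝ) : ℂ) * (g r * conj (h r))) *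
      (((r ^ p : ℝ) : ℂ) / (((r ^ (p+1) : ℝ) : ℂ) - z))‖ ≤ C * (En q g + En q h) := by
  set A : ℝ := (q + 2) * (q + 2) + 1 with hA
  have hA0 : 0 < A := by positivity
  refine ⟨3 + (q + 2) * π + 4 * A, by positivity, fun z hz g h => ?_⟩
  set E := En q g + En q h with hE
  have hE0 : 0 ≤ E := add_nonneg (En_nonneg q g) (En_nonneg q h)
  set B : ℝ → ℂ := fun r => ((r ^ (q+1) : ℝ) : ℂ) * (g r * conj (h r)) with hB
  set k : ℝ → ℂ := fun r => ((r ^ p : ℝ) : ℂ) / (((r ^ (p+1) : ℝ) : ℂ) - z) with hk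
  obtain ⟨d, hd, hdx⟩ := ker_lb hz
  have hBn : ∀ r : ℝ, 0 < r → ‖B r‖ = r ^ (q+1) * (‖g r‖ * ‖h r‖) := by
    intro r hr
    rw [hB]
    simp [abs_of_pos hr]
  have hkn : ∀ r : ℝ, 0 < r → ‖k r‖ = r ^ p / ‖((r ^ (p+1) : ℝ) : ℂ) - z‖ := by
    intro r hr
    rw [hk]
    simp only
    rw [norm_div, Complex.norm_real, Real.norm_of_nonneg (by positivity)]
  have hmeas : AEStronglyMeasurable (fun r => B r * k r) (volume.restrict (Ioi 0)) := by
    apply Measurable.aestronglyMeasurable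
    have m1 : Continuous B := by rw [hB]; fun_prop
    have m2 : Measurable k := by rw [hk]; fun_prop
    exact m1.measurable.mul m2
  have hint : IntegrableOn (fun r => B r * k r) (Ioi 0) := by
    refine (((sz_int (q+1+p) g h).const_mul d⁻¹).integrableOn).mono' hmeas ?_
    refine (ae_restrict_iff' measurableSet_Ioi).2 (Eventually.of_forall fun r hr => ?_)
    have hr : 0 < r := hr
    rw [norm_mul, hBn r hr, hkn r hr]
    have := hdx (r ^ (p+1)) (by positivity)
    calc r ^ (q + 1) * (‖g r‖ * ‖h r‖) * (r ^ p / ‖((r ^ (p+1) : ℝ) : ℂ) - z‖)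
        ≤ r ^ (q + 1) * (‖g r‖ * ‖h r‖) * (r ^ p / d) := by gcongr
      _ = _ := by rw [pow_add r (q+1) p]; field_simp
  -- far region
  have far : ∀ S : Set ℝ, MeasurableSet S → S ⊆ Ioi 0 →
      (∀ r ∈ S, r ^ (p+1) ≤ 3 * ‖((r ^ (p+1) : ℝ) : ℂ) - z‖) →
      ‖∫ r in S, B r * k r‖ ≤ 3 * E := by
    intro S hS hS0 hb
    have i1 := sz_int2 q g
    have i2 := sz_int2 q h
    have i3 : Integrable (fun r : ℝ => 3 * (r ^ q * ‖g r‖ ^ 2 + r ^ q * ‖h r‖ ^ 2)) :=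
      (i1.add i2).const_mul 3
    calc ‖∫ r in S, B r * k r‖ ≤ ∫ r in S, 3 * (r ^ q * ‖g r‖ ^ 2 + r ^ q * ‖h r‖ ^ 2) := by
          refine norm_integral_le_of_norm_le i3.integrableOn ?_
          refine (ae_restrict_iff' hS).2 (Eventually.of_forall fun r hr' => ?_)
          have hr : 0 < r := hS0 hr'
          have hb' := hb r hr'
          rw [norm_mul, hBn r hr, hkn r hr]
          set N := ‖((r ^ (p+1) : ℝ) : ℂ) - z‖
          have hN : 0 < N := by have : 0 < r ^ (p+1) := by positivity
                                linarith
          have : r ^ (q+1) * (‖g r‖ * ‖h r‖) * (r ^ p / N) =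
              r ^ q * (‖g r‖ * ‖h r‖) * (r ^ (p+1) / N) := by
            rw [pow_succ, pow_succ]; ring
          rw [this]
          calc _ ≤ r ^ q * (‖g r‖ * ‖h r‖) * 3 := by
                gcongr
                exact (div_le_iff₀ hN).2 hb'
            _ ≤ _ := by
                have := mul_nonneg (pow_nonneg hr.le q) (sq_nonneg (‖g r‖ - ‖h r‖))
                have h2 : 0 ≤ r ^ q * (‖g r‖ ^2) := by positivity
                have h3 : 0 ≤ r ^ q * (‖h r‖ ^2) := by positivity
                nlinarith
      _ ≤ ∫ r in Ioi 0, 3 * (r ^ q * ‖g r‖ ^ 2 + r ^ q * ‖h r‖ ^ 2) := by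
          refine setIntegral_mono_set i3.integrableOn ?_ hS0.eventuallyLE
          refine (ae_restrict_iff' measurableSet_Ioi).2 (Eventually.of_forall fun x hx => ?_)
          have hx : 0 < x := hx
          simp only [Pi.zero_apply]
          positivity
      _ ≤ 3 * E := by
          rw [integral_const_mul, integral_add i1.integrableOn i2.integrableOn, hE, En, En]
          have : ∀ g : 𝓢(ℝ, ℂ), 0 ≤ ∫ r in Ioi (0:ℝ), r ^ (q+2) * ‖SchwartzMap.derivCLM ℝ ℂ g r‖ ^ 2 := by
            intro g
            refine setIntegral_nonneg measurableSet_Ioi fun x hx => ?_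
            have hx : 0 < x := hx
            positivity
          linarith [this g, this h]
  have hqpi : 0 ≤ ((q:ℝ) + 2) * π * E := by positivity
  have hAE : 0 ≤ 4 * A * E := by positivity
  rcases le_or_gt z.re 0 with hu | hu
  · have := far (Ioi 0) measurableSet_Ioi subset_rfl (by
      intro r hr
      have hr : 0 < r := hr
      have h1 := Complex.re_le_norm (((r ^ (p+1) : ℝ) : ℂ) - z)
      rw [Complex.sub_re, Complex.ofReal_re] at h1
      have : 0 < r ^ (p+1) := by positivity
      linarith)
    refine this.trans ?_
    nlinarith
  · have him : z.im ≠ 0 := by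
      rcases hz with h | h
      · exact h
      · exact absurd h (by linarith)
    have root : ∀ x : ℝ, 0 < x → ∃ y : ℝ, 0 < y ∧ y ^ (p+1) = x := fun x hx =>
      ⟨x ^ (((p+1 : ℕ) : ℝ)⁻¹), by positivity, Real.rpow_inv_natCast_pow hx.le (by omega)⟩
    obtain ⟨l, hl, el⟩ := root z.re hu
    obtain ⟨a, ha, ea⟩ := root (z.re / 2) (by positivity)
    obtain ⟨b, hb, eb⟩ := root (3 * z.re / 2) (by positivity)
    have hal : a < l := lt_of_pow_lt_pow_left₀ (p+1) hl.le (by rw [ea, el]; linarith)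
    have hlb : l < b := lt_of_pow_lt_pow_left₀ (p+1) hb.le (by rw [eb, el]; linarith)
    have hal2 : l / 2 ≤ a := by
      refine le_of_pow_le_pow_left₀ (n := p+1) (by omega) ha.le ?_
      rw [ea, div_pow, el]
      have : (2:ℝ) ^ 1 ≤ 2 ^ (p+1) := pow_le_pow_right₀ (by norm_num) (by omega)
      gcongr
      simpa using this
    have hlb2 : b ≤ 2 * l := by
      refine le_of_pow_le_pow_left₀ (n := p+1) (by omega) (by positivity) ?_
      rw [eb, mul_pow, el]
      have : (2:ℝ) ^ 1 ≤ 2 ^ (p+1) := pow_le_pow_right₀ (by norm_num) (by omega)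
      nlinarith
    have hsub : Ioc a b ⊆ Ioi 0 := fun x hx => lt_trans ha hx.1
    have hsplit : ∫ r in Ioi 0, B r * k r = (∫ r in Ioi 0 \ Ioc a b, B r * k r) +
        ∫ r in Ioc a b, B r * k r := by
      rw [setIntegral_sdiff measurableSet_Ioc hint hsub]; ring
    have hfar := far (Ioi 0 \ Ioc a b) (measurableSet_Ioi.diff measurableSet_Ioc) sdiff_subset (by
      rintro r ⟨hr, hr2⟩
      have hr : 0 < r := hr
      have h1 := Complex.abs_re_le_norm (((r ^ (p+1) : ℝ) : ℂ) - z)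
      rw [Complex.sub_re, Complex.ofReal_re] at h1
      rw [mem_Ioc, not_and_or, not_lt, not_le] at hr2
      rcases hr2 with h | h
      · have : r ^ (p+1) ≤ a ^ (p+1) := by gcongr
        have := neg_abs_le (r ^ (p+1) - z.re)
        linarith
      · have : b ^ (p+1) ≤ r ^ (p+1) := by gcongr
        have := le_abs_self (r ^ (p+1) - z.re)
        linarith)
    obtain ⟨ik, hkint⟩ := ker_int p him ha hb ea eb
    have hBl : ‖B l‖ ≤ (q + 2) * E := by
      rw [hBn l hl]
      have a1 := sz_sup q g hl
      have a2 := sz_sup q h hl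
      have := mul_nonneg (pow_nonneg hl.le (q+1)) (sq_nonneg (‖g l‖ - ‖h l‖))
      have b1 : 0 ≤ l ^ (q+1) * ‖g l‖ ^ 2 := by positivity
      have b2 : 0 ≤ l ^ (q+1) * ‖h l‖ ^ 2 := by positivity
      rw [hE]
      nlinarith
    have hab : a ≤ b := by linarith
    have ikk : IntegrableOn k (Ioc a b) := (intervalIntegrable_iff_integrableOn_Ioc_of_le hab).1 ik
    have hnear : ∫ r in Ioc a b, B r * k r = B l * (∫ r in Ioc a b, k r) +
        ∫ r in Ioc a b, (B r - B l) * k r := by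
      have i1 : IntegrableOn (fun r => B l * k r) (Ioc a b) := ikk.const_mul _
      have i2 : IntegrableOn (fun r => (B r - B l) * k r) (Ioc a b) := by
        refine ((hint.mono_set hsub).sub i1).congr (Eventually.of_forall fun r => ?_)
        simp only [Pi.sub_apply]
        ring
      rw [← integral_const_mul, ← integral_add i1 i2]
      refine integral_congr_ae (Eventually.of_forall fun r => ?_)
      simp only
      ring
    have n1 : ‖B l * (∫ r in Ioc a b, k r)‖ ≤ (q + 2) * E * π := by
      rw [norm_mul, ← intervalIntegral.integral_of_le hab]
      gcongr
    have n2 : ‖∫ r in Ioc a b, (B r - B l) * k r‖ ≤ 4 * A * E := by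
      obtain ⟨w1, w2⟩ := w_int hl
      have w3 : IntegrableOn (fun x : ℝ => |x - l| ^ (-1/2 : ℝ)) (Ioc 0 (2 * l)) := by
        rw [← intervalIntegrable_iff_integrableOn_Ioc_of_le (by linarith)]
        have := w1.comp_sub_right l
        convert this using 1 <;> ring
      have w4 : ∫ x in Ioc 0 (2 * l), |x - l| ^ (-1/2 : ℝ) = 4 * √l := by
        rw [← intervalIntegral.integral_of_le (by linarith), ← w2,
          intervalIntegral.integral_comp_sub_right (fun x : ℝ => |x| ^ (-1/2 : ℝ))]
        congr 1 <;> ring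
      have hs2 : Ioc a b ⊆ Ioc 0 (2 * l) := Ioc_subset_Ioc ha.le hlb2
      calc ‖∫ r in Ioc a b, (B r - B l) * k r‖
          ≤ ∫ r in Ioc a b, A * E / √l * |r - l| ^ (-1/2 : ℝ) := by
            refine norm_integral_le_of_norm_le ((w3.mono_set hs2).const_mul _) ?_
            refine (ae_restrict_iff' measurableSet_Ioc).2 ?_
            have hne : ∀ᵐ r : ℝ, r ≠ l := by simp [ae_iff]
            filter_upwards [hne] with r hrl hr
            have hr0 : 0 < r := hsub hr
            have c1 := holder_B q g h hl (by linarith [hr.1] : l / 2 ≤ r) (by linarith [hr.2])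
            have c2 := ker_ptwise p (z := z) hl hr0 el
            have hd : 0 < |r - l| := abs_pos.2 (sub_ne_zero.2 hrl)
            have c3 : ‖k r‖ ≤ 1 / |r - l| := (le_div_iff₀ hd).2 c2
            rw [norm_mul]
            calc ‖B r - B l‖ * ‖k r‖ ≤ (A * E * √(|r - l| / l)) * (1 / |r - l|) := by
                  gcongr
              _ = _ := by
                  rw [Real.sqrt_div hd.le, show (-1/2:ℝ) = -(1/2) by norm_num,
                    Real.rpow_neg hd.le, ← Real.sqrt_eq_rpow]
                  have : |r - l| = √|r - l| * √|r - l| := (Real.mul_self_sqrt hd.le).symm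
                  have hs : √|r - l| ≠ 0 := (Real.sqrt_pos.2 hd).ne'
                  have hs' : √l ≠ 0 := (Real.sqrt_pos.2 hl).ne'
                  field_simp
                  rw [Real.sq_sqrt hd.le]
        _ ≤ ∫ r in Ioc 0 (2*l), A * E / √l * |r - l| ^ (-1/2 : ℝ) := by
            refine setIntegral_mono_set (w3.const_mul _) ?_ hs2.eventuallyLE
            refine Eventually.of_forall fun x => ?_
            simp only [Pi.zero_apply]
            positivity
        _ = 4 * A * E := by
            rw [integral_const_mul, w4]
            have hs' : √l ≠ 0 := (Real.sqrt_pos.2 hl).ne'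
            field_simp
    rw [hsplit, hnear]
    refine (norm_add_le _ _).trans ?_
    have := norm_add_le (B l * (∫ r in Ioc a b, k r)) (∫ r in Ioc a b, (B r - B l) * k r)
    nlinarith

section polar
variable {E : Type*} [NormedAddCommGroup E] [NormedSpace ℝ E] [MeasurableSpace E]
  [Nontrivial E] [FiniteDimensional ℝ E] [BorelSpace E] (μ : Measure E) [μ.IsAddHaarMeasure]

lemma polar_lintegral (f : E → ℝ≥0∞) (hf : Measurable f) :
    ∫⁻ x, f x ∂μ = ∫⁻ ω, ∫⁻ r in Ioi (0:ℝ),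
      ENNReal.ofReal (r ^ (Module.finrank ℝ E - 1)) * f (r • (ω : E)) ∂volume ∂μ.toSphere := by
  calc ∫⁻ x, f x ∂μ = ∫⁻ x : ({(0)}ᶜ : Set E), f x ∂(μ.comap (↑)) := by
        rw [lintegral_subtype_comap (measurableSet_singleton _).compl f, restrict_compl_singleton]
    _ = ∫⁻ y, f ((y.2 : ℝ) • (y.1 : E)) ∂μ.toSphere.prod (.volumeIoiPow (Module.finrank ℝ E - 1)) := by
        rw [← μ.measurePreserving_homeomorphUnitSphereProd.lintegral_comp_emb
          (Homeomorph.measurableEmbedding _)]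
        refine lintegral_congr fun x => ?_
        congr 1
        have := homeomorphUnitSphereProd_symm_apply_coe E (homeomorphUnitSphereProd E x)
        rw [← this, Homeomorph.symm_apply_apply]
    _ = ∫⁻ ω, ∫⁻ r, f ((r : ℝ) • (ω : E)) ∂(Measure.volumeIoiPow (Module.finrank ℝ E - 1)) ∂μ.toSphere := by
        apply lintegral_prod
        apply Measurable.aemeasurable
        apply hf.comp
        fun_prop
    _ = _ := by
        refine lintegral_congr fun ω => ?_
        rw [Measure.volumeIoiPow, lintegral_withDensity_eq_lintegral_mul]
        · exact lintegral_subtype_comap measurableSet_Ioi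
            (fun r : ℝ => ENNReal.ofReal (r ^ (Module.finrank ℝ E - 1)) * f (r • (ω : E)))
        · fun_prop
        · apply hf.comp
          fun_prop

lemma polar_integral (F : E → ℂ) (hF : Integrable F μ) :
    ∫ x, F x ∂μ = ∫ ω, ∫ r in Ioi (0:ℝ),
      ((r ^ (Module.finrank ℝ E - 1) : ℝ)) • F (r • (ω : E)) ∂volume ∂μ.toSphere := by
  have key : ∀ x : ({(0)}ᶜ : Set E), ((homeomorphUnitSphereProd E x).2 : ℝ) • ((homeomorphUnitSphereProd E x).1 : E) = x := by
    intro x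
    have := homeomorphUnitSphereProd_symm_apply_coe E (homeomorphUnitSphereProd E x)
    rw [← this, Homeomorph.symm_apply_apply]
  have hI : Integrable (fun y : Metric.sphere (0:E) 1 × Ioi (0:ℝ) => F ((y.2 : ℝ) • (y.1 : E)))
      (μ.toSphere.prod (.volumeIoiPow (Module.finrank ℝ E - 1))) := by
    rw [← μ.measurePreserving_homeomorphUnitSphereProd.integrable_comp_emb
      (Homeomorph.measurableEmbedding _)]
    have h2 : IntegrableOn F ({0}ᶜ) μ := hF.integrableOn
    rw [integrableOn_iff_comap_subtypeVal (measurableSet_singleton _).compl] at h2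
    refine h2.congr (.of_forall fun x => ?_)
    simp only [Function.comp, key]
  calc ∫ x, F x ∂μ = ∫ x : ({(0)}ᶜ : Set E), F x ∂(μ.comap (↑)) := by
        rw [integral_subtype_comap (measurableSet_singleton _).compl F, restrict_compl_singleton]
    _ = ∫ y, F ((y.2 : ℝ) • (y.1 : E)) ∂μ.toSphere.prod (.volumeIoiPow (Module.finrank ℝ E - 1)) := by
        rw [← μ.measurePreserving_homeomorphUnitSphereProd.integral_comp
          (Homeomorph.measurableEmbedding _)]
        refine integral_congr_ae (.of_forall fun x => ?_)
        simp only [key]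
    _ = ∫ ω, ∫ r, F ((r : ℝ) • (ω : E)) ∂(Measure.volumeIoiPow (Module.finrank ℝ E - 1)) ∂μ.toSphere :=
        integral_prod _ hI
    _ = _ := by
        refine integral_congr_ae (.of_forall fun ω => ?_)
        simp only [Measure.volumeIoiPow, ENNReal.ofReal]
        rw [integral_withDensity_eq_integral_smul,
          integral_subtype_comap measurableSet_Ioi
            fun a ↦ Real.toNNReal (a ^ (Module.finrank ℝ E - 1)) • F (a • (ω : E)),
          setIntegral_congr_fun measurableSet_Ioi fun x hx ↦ ?_]
        · rw [NNReal.smul_def, Real.coe_toNNReal _ (pow_nonneg hx.out.le _)]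
        · exact (measurable_subtype_coe.pow_const _).real_toNNReal
end polar

open LineDeriv in
/-- coordinate derivative -/
def pd {n : ℕ} (i : Fin n) (φ : 𝓢(Euc n, ℂ)) : 𝓢(Euc n, ℂ) :=
  ∂_{(EuclideanSpace.single i (1:ℝ) : Euc n)} φ

/-- restriction to a ray -/
def ray {n : ℕ} (φ : 𝓢(Euc n, ℂ)) (ω : Metric.sphere (0 : Euc n) 1) : 𝓢(ℝ, ℂ) :=
  SchwartzMap.compCLMOfAntilipschitz ℝ (K := 1) (g := fun r : ℝ => r • (ω : Euc n))
    (((ContinuousLinearMap.id ℝ ℝ).smulRight (ω : Euc n)).hasTemperateGrowth)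
    (by
      refine AntilipschitzWith.of_le_mul_dist fun x y => ?_
      rw [dist_eq_norm, dist_eq_norm, ← sub_smul, norm_smul, norm_eq_of_mem_sphere]
      simp) φ

lemma ray_apply {n : ℕ} (φ : 𝓢(Euc n, ℂ)) (ω : Metric.sphere (0 : Euc n) 1) (r : ℝ) :
    ray φ ω r = φ (r • (ω : Euc n)) := rfl

lemma ray_deriv_eq {n : ℕ} (φ : 𝓢(Euc n, ℂ)) (ω : Metric.sphere (0 : Euc n) 1) (r : ℝ) :
    SchwartzMap.derivCLM ℝ ℂ (ray φ ω) r = fderiv ℝ φ (r • (ω : Euc n)) (ω : Euc n) := by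
  rw [SchwartzMap.derivCLM_apply]
  apply HasDerivAt.deriv
  have h2 : HasDerivAt (fun r : ℝ => r • (ω : Euc n)) (ω : Euc n) r := by
    simpa using (hasDerivAt_id r).smul_const (ω : Euc n)
  exact (φ.differentiableAt.hasFDerivAt (x := r • (ω : Euc n))).comp_hasDerivAt r h2

lemma ray_deriv {n : ℕ} (φ : 𝓢(Euc n, ℂ)) (ω : Metric.sphere (0 : Euc n) 1) (r : ℝ) :
    ‖SchwartzMap.derivCLM ℝ ℂ (ray φ ω) r‖ ^ 2 ≤ ∑ i, ‖pd i φ (r • (ω : Euc n))‖ ^ 2 := by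
  have h3 : (ω : Euc n) = ∑ i, (ω : Euc n) i • EuclideanSpace.single i (1:ℝ) := by
    conv_lhs => rw [← (EuclideanSpace.basisFun (Fin n) ℝ).sum_repr (ω : Euc n)]
    simp
  have h4 : SchwartzMap.derivCLM ℝ ℂ (ray φ ω) r
      = ∑ i, (ω : Euc n) i • pd i φ (r • (ω : Euc n)) := by
    rw [ray_deriv_eq]
    have h1 := congrArg (fderiv ℝ φ (r • (ω : Euc n))) h3
    rw [map_sum] at h1
    rw [h1]
    simp only [map_smul]
    rfl
  rw [h4]
  have h5 : ∑ i, ‖(ω : Euc n) i‖ ^ 2 = 1 := by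
    rw [← EuclideanSpace.norm_sq_eq, norm_eq_of_mem_sphere]; norm_num
  calc ‖∑ i, (ω : Euc n) i • pd i φ (r • (ω : Euc n))‖ ^ 2
      ≤ (∑ i, ‖(ω : Euc n) i‖ * ‖pd i φ (r • (ω : Euc n))‖) ^ 2 := by
        gcongr
        refine (norm_sum_le _ _).trans (le_of_eq ?_)
        simp only [norm_smul]
    _ ≤ (∑ i, ‖(ω : Euc n) i‖ ^ 2) * ∑ i, ‖pd i φ (r • (ω : Euc n))‖ ^ 2 :=
        Finset.sum_mul_sq_le_sq_mul_sq _ _ _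
    _ = _ := by rw [h5, one_mul]

/-- weighted norm -/
def W {n : ℕ} (k : ℕ) (φ : 𝓢(Euc n, ℂ)) : ℝ≥0∞ :=
  ∫⁻ x, ENNReal.ofReal ((‖x‖ ^ (2 * k))⁻¹ * ‖φ x‖ ^ 2)

lemma euc_nontrivial {n : ℕ} (hn : 0 < n) : Nontrivial (Euc n) := by
  have : Nonempty (Fin n) := ⟨⟨0, hn⟩⟩
  infer_instance

lemma polar_weight {n k : ℕ} (hk : 2 * k < n) (ω : Metric.sphere (0 : Euc n) 1) {r : ℝ}
    (hr : 0 < r) (c : ℝ) :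
    ENNReal.ofReal (r ^ (n - 1)) * ENNReal.ofReal ((‖r • (ω : Euc n)‖ ^ (2 * k))⁻¹ * c)
      = ENNReal.ofReal (r ^ (n - 1 - 2 * k) * c) := by
  rw [← ENNReal.ofReal_mul (by positivity), norm_smul, norm_eq_of_mem_sphere, mul_one,
    Real.norm_of_nonneg hr.le]
  congr 1
  rw [show n - 1 = (n - 1 - 2 * k) + 2 * k by omega, pow_add]
  simp only [Nat.add_sub_cancel]
  field_simp

lemma W_polar {n k : ℕ} (hk : 2 * k < n) (φ : 𝓢(Euc n, ℂ)) :
    W k φ = ∫⁻ ω, ENNReal.ofReal (∫ r in Ioi (0:ℝ), r ^ (n - 1 - 2 * k) * ‖ray φ ω r‖ ^ 2)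
      ∂(volume : Measure (Euc n)).toSphere := by
  have := euc_nontrivial (n := n) (by omega)
  rw [W, polar_lintegral volume _ (by have := φ.continuous; fun_prop)]
  refine lintegral_congr fun ω => ?_
  rw [ofReal_integral_eq_lintegral_ofReal (sz_int2 _ _).integrableOn]
  · refine setLIntegral_congr_fun measurableSet_Ioi fun r hr => ?_
    simp only [finrank_euclideanSpace_fin, ray_apply]
    exact polar_weight hk ω hr _
  · filter_upwards [ae_restrict_mem measurableSet_Ioi] with r hr
    have : (0:ℝ) < r := hr
    positivity

lemma W_polar_deriv {n k : ℕ} (hk : 2 * k < n) (φ : 𝓢(Euc n, ℂ)) :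
    ∫⁻ ω, ENNReal.ofReal (∫ r in Ioi (0:ℝ), r ^ (n - 1 - 2 * k) *
      ‖SchwartzMap.derivCLM ℝ ℂ (ray φ ω) r‖ ^ 2) ∂(volume : Measure (Euc n)).toSphere
      ≤ ∑ i, W k (pd i φ) := by
  have := euc_nontrivial (n := n) (by omega)
  have hm : ∀ i, Measurable (fun x : Euc n =>
      ENNReal.ofReal ((‖x‖ ^ (2 * k))⁻¹ * ‖pd i φ x‖ ^ 2)) := fun i => by
    have := (pd i φ).continuous; fun_prop
  have : ∑ i, W k (pd i φ) = ∫⁻ x, ∑ i, ENNReal.ofReal ((‖x‖ ^ (2 * k))⁻¹ * ‖pd i φ x‖ ^ 2) := by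
    rw [lintegral_finsetSum _ (fun i _ => hm i)]; rfl
  rw [this, polar_lintegral volume _ (Finset.measurable_fun_sum _ fun i _ => hm i)]
  refine lintegral_mono fun ω => ?_
  rw [ofReal_integral_eq_lintegral_ofReal (sz_int2 _ _).integrableOn]
  · refine setLIntegral_mono' measurableSet_Ioi fun r hr => ?_
    simp only [finrank_euclideanSpace_fin]
    have hr' : (0:ℝ) < r := hr
    rw [Finset.mul_sum]
    simp only [polar_weight hk ω hr']
    rw [← ENNReal.ofReal_sum_of_nonneg (fun i _ => by positivity), ← Finset.mul_sum]
    gcongr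
    exact ray_deriv φ ω r
  · filter_upwards [ae_restrict_mem measurableSet_Ioi] with r hr
    have : (0:ℝ) < r := hr
    positivity

lemma W_hardy {n k : ℕ} (hk : 2 * (k + 1) < n) (φ : 𝓢(Euc n, ℂ)) :
    W (k + 1) φ ≤ 4 * ∑ i, W k (pd i φ) := by
  rw [W_polar hk]
  refine le_trans ?_ (mul_le_mul_right (W_polar_deriv (k := k) (by omega) φ) 4)
  rw [← lintegral_const_mul' _ _ (by norm_num)]
  refine lintegral_mono fun ω => ?_
  rw [show (4 : ℝ≥0∞) = ENNReal.ofReal 4 by norm_num, ← ENNReal.ofReal_mul (by norm_num)]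
  apply ENNReal.ofReal_le_ofReal
  have := sz_hardy (n - 1 - 2 * (k + 1)) (ray φ ω)
  rwa [show n - 1 - 2 * (k + 1) + 2 = n - 1 - 2 * k by omega] at this

lemma En_polar {n k : ℕ} (hk : 2 * (k + 1) < n) (φ : 𝓢(Euc n, ℂ)) :
    ∫⁻ ω, ENNReal.ofReal (En (n - 1 - 2 * (k + 1)) (ray φ ω)) ∂(volume : Measure (Euc n)).toSphere
      ≤ 5 * ∑ i, W k (pd i φ) := by
  refine le_trans ?_ (mul_le_mul_right (W_polar_deriv (k := k) (by omega) φ) 5)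
  rw [← lintegral_const_mul' _ _ (by norm_num)]
  refine lintegral_mono fun ω => ?_
  rw [show (5 : ℝ≥0∞) = ENNReal.ofReal 5 by norm_num, ← ENNReal.ofReal_mul (by norm_num)]
  apply ENNReal.ofReal_le_ofReal
  have := sz_hardy (n - 1 - 2 * (k + 1)) (ray φ ω)
  rw [show n - 1 - 2 * (k + 1) + 2 = n - 1 - 2 * k by omega] at this
  unfold En
  rw [show n - 1 - 2 * (k + 1) + 2 = n - 1 - 2 * k by omega]
  linarith

/-- moment norm -/
def X {n : ℕ} (k : ℕ) (f : 𝓢(Euc n, ℂ)) : ℝ≥0∞ :=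
  ∫⁻ x, ENNReal.ofReal (‖x‖ ^ (2 * k) * ‖f x‖ ^ 2)

lemma W_zero {n : ℕ} (f : 𝓢(Euc n, ℂ)) : W 0 (FourierTransform.fourier f) = X 0 f := by
  have hi : ∀ g : 𝓢(Euc n, ℂ), Integrable (fun x => ‖g x‖ ^ 2) := fun g =>
    (memLp_two_iff_integrable_sq_norm (by have := g.continuous; fun_prop)).1 (g.memLp 2)
  unfold W X
  simp only [mul_zero, pow_zero, inv_one, one_mul]
  rw [← ofReal_integral_eq_lintegral_ofReal (hi _) (.of_forall fun _ => by positivity),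
    ← ofReal_integral_eq_lintegral_ofReal (hi _) (.of_forall fun _ => by positivity),
    SchwartzMap.integral_norm_sq_fourier]

/-- multiply by coordinate -/
def mulX {n : ℕ} (i : Fin n) (f : 𝓢(Euc n, ℂ)) : 𝓢(Euc n, ℂ) :=
  -(2 * π * Complex.I) • SchwartzMap.smulLeftCLM ℂ
    (fun x : Euc n => inner ℝ x (EuclideanSpace.single i (1:ℝ))) f

lemma pd_fourier {n : ℕ} (i : Fin n) (f : 𝓢(Euc n, ℂ)) :
    pd i (FourierTransform.fourier f) = FourierTransform.fourier (mulX i f) :=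
  SchwartzMap.lineDerivOp_fourier_eq f _

lemma mulX_norm {n : ℕ} (i : Fin n) (f : 𝓢(Euc n, ℂ)) (x : Euc n) :
    ‖mulX i f x‖ = 2 * π * (‖x i‖ * ‖f x‖) := by
  have : (fun x : Euc n => inner ℝ x (EuclideanSpace.single i (1:ℝ))).HasTemperateGrowth :=
    ((innerSL ℝ).flip _).hasTemperateGrowth
  unfold mulX
  rw [smul_apply, SchwartzMap.smulLeftCLM_apply_apply this]
  simp [EuclideanSpace.inner_single_right, abs_of_pos Real.pi_pos]

lemma X_sum {n : ℕ} (k : ℕ) (f : 𝓢(Euc n, ℂ)) :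
    ∑ i, X k (mulX i f) = ENNReal.ofReal ((2 * π) ^ 2) * X (k + 1) f := by
  have hm : ∀ i, Measurable (fun x : Euc n =>
      ENNReal.ofReal (‖x‖ ^ (2 * k) * ‖mulX i f x‖ ^ 2)) := fun i => by
    have := (mulX i f).continuous; fun_prop
  have h := lintegral_finsetSum (μ := (volume : Measure (Euc n))) Finset.univ (fun i _ => hm i)
  unfold X
  rw [← h, ← lintegral_const_mul' _ _ (by simp)]
  refine lintegral_congr fun x => ?_
  rw [← ENNReal.ofReal_sum_of_nonneg (fun i _ => by positivity),
    ← ENNReal.ofReal_mul (by positivity), ← Finset.mul_sum]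
  congr 1
  have h2 : ∑ i, ‖mulX i f x‖ ^ 2 = (2 * π) ^ 2 * (‖x‖ ^ 2 * ‖f x‖ ^ 2) := by
    rw [EuclideanSpace.norm_sq_eq, Finset.sum_mul, Finset.mul_sum]
    refine Finset.sum_congr rfl fun i _ => ?_
    rw [mulX_norm]; ring
  rw [h2]; ring

lemma W_fourier {n : ℕ} (k : ℕ) (hk : 2 * k < n) : ∀ f : 𝓢(Euc n, ℂ),
    W k (FourierTransform.fourier f) ≤ ENNReal.ofReal ((4 * (2 * π) ^ 2) ^ k) * X k f := by
  induction k with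
  | zero => intro f; simp [W_zero]
  | succ k ih =>
    intro f
    refine (W_hardy hk _).trans ?_
    simp only [pd_fourier]
    calc 4 * ∑ i, W k (FourierTransform.fourier (mulX i f))
        ≤ 4 * ∑ i, ENNReal.ofReal ((4 * (2 * π) ^ 2) ^ k) * X k (mulX i f) := by
          gcongr with i
          exact ih (by omega) _
      _ = ENNReal.ofReal ((4 * (2 * π) ^ 2) ^ (k + 1)) * X (k + 1) f := by
          rw [← Finset.mul_sum, X_sum, ← mul_assoc, ← mul_assoc,
            show (4 : ℝ≥0∞) = ENNReal.ofReal 4 by norm_num,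
            ← ENNReal.ofReal_mul (by norm_num), ← ENNReal.ofReal_mul (by positivity)]
          congr 2
          ring

lemma En_fourier {n : ℕ} (k : ℕ) (hk : 2 * (k + 1) < n) : ∃ C : ℝ, 0 < C ∧ ∀ f : 𝓢(Euc n, ℂ),
    ∫⁻ ω, ENNReal.ofReal (En (n - 1 - 2 * (k + 1)) (ray (FourierTransform.fourier f) ω))
      ∂(volume : Measure (Euc n)).toSphere ≤ ENNReal.ofReal C * X (k + 1) f := by
  refine ⟨5 * (4 * (2 * π) ^ 2) ^ k * (2 * π) ^ 2, by positivity, fun f => ?_⟩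
  refine (En_polar hk _).trans ?_
  simp only [pd_fourier]
  calc 5 * ∑ i, W k (FourierTransform.fourier (mulX i f))
      ≤ 5 * ∑ i, ENNReal.ofReal ((4 * (2 * π) ^ 2) ^ k) * X k (mulX i f) := by
        gcongr with i
        exact W_fourier k (by omega) _
    _ = _ := by
        rw [← Finset.mul_sum, X_sum, ← mul_assoc, ← mul_assoc,
          show (5 : ℝ≥0∞) = ENNReal.ofReal 5 by norm_num,
          ← ENNReal.ofReal_mul (by norm_num), ← ENNReal.ofReal_mul (by positivity)]

lemma En_meas {n : ℕ} (q : ℕ) (φ : 𝓢(Euc n, ℂ)) :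
    Measurable (fun ω : Metric.sphere (0 : Euc n) 1 => En q (ray φ ω)) := by
  unfold En
  simp only [ray_deriv_eq, ray_apply]
  have h1 : Continuous (fun x : Euc n => fderiv ℝ φ x) := (φ.smooth 1).continuous_fderiv (by norm_num)
  have h2 := φ.continuous
  apply Measurable.add
  · refine (StronglyMeasurable.integral_prod_right (ν := volume.restrict (Ioi (0:ℝ)))
      (f := fun ω : Metric.sphere (0 : Euc n) 1 => fun r : ℝ => r ^ q * ‖φ (r • (ω : Euc n))‖ ^ 2) ?_).measurable
    apply Continuous.stronglyMeasurable
    unfold Function.uncurry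
    fun_prop
  · refine (StronglyMeasurable.integral_prod_right (ν := volume.restrict (Ioi (0:ℝ)))
      (f := fun ω : Metric.sphere (0 : Euc n) 1 => fun r : ℝ =>
        r ^ (q + 2) * ‖fderiv ℝ φ (r • (ω : Euc n)) (ω : Euc n)‖ ^ 2) ?_).measurable
    apply Continuous.stronglyMeasurable
    unfold Function.uncurry
    have h3 : Continuous (fun x : Metric.sphere (0 : Euc n) 1 × ℝ =>
        fderiv ℝ φ (x.2 • (x.1 : Euc n)) (x.1 : Euc n)) :=
      (h1.comp (by fun_prop)).clm_apply (by fun_prop)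
    exact (continuous_snd.pow _).mul (h3.norm.pow 2)

lemma sz_mul_conj_int {n : ℕ} (a b : 𝓢(Euc n, ℂ)) : Integrable (fun x => a x * conj (b x)) := by
  have h : MemLp (fun x => conj (b x)) 2 := (b.memLp 2 (volume : Measure (Euc n))).star
  exact (a.memLp 2 (volume : Measure (Euc n))).integrable_mul h

lemma bil (n m : ℕ) (hm : 1 ≤ m) (hn : 2 * m < n) : ∃ C : ℝ, 0 < C ∧
    ∀ z : ℂ, (z.im ≠ 0 ∨ z.re < 0) → ∀ a f g : 𝓢(Euc n, ℂ),
      (∀ ξ, a ξ * (((‖ξ‖ ^ (2 * m) : ℝ) : ℂ) - z) = FourierTransform.fourier f ξ) →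
      ‖∫ ξ, a ξ * conj (FourierTransform.fourier g ξ)‖ₑ
        ≤ ENNReal.ofReal C * (X m f + X m g) := by
  obtain ⟨k, rfl⟩ : ∃ k, m = k + 1 := ⟨m - 1, by omega⟩
  obtain ⟨C₁, hC₁, h₁⟩ := radial_main (2 * (k + 1) - 1) (n - 1 - 2 * (k + 1))
  obtain ⟨C₂, hC₂, h₂⟩ := En_fourier k hn
  refine ⟨C₁ * C₂, by positivity, fun z hz a f g ha => ?_⟩
  have := euc_nontrivial (n := n) (by omega)
  rw [polar_integral volume _ (sz_mul_conj_int _ _)]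
  refine (enorm_integral_le_lintegral_enorm _).trans ?_
  obtain ⟨d, hd, hdz⟩ := ker_lb hz
  calc _ ≤ ∫⁻ ω, ENNReal.ofReal C₁ * (ENNReal.ofReal
          (En (n - 1 - 2 * (k + 1)) (ray (FourierTransform.fourier f) ω))
          + ENNReal.ofReal (En (n - 1 - 2 * (k + 1)) (ray (FourierTransform.fourier g) ω)))
          ∂(volume : Measure (Euc n)).toSphere := by
        refine lintegral_mono fun ω => ?_
        rw [← ENNReal.ofReal_add (En_nonneg _ _) (En_nonneg _ _),
          ← ENNReal.ofReal_mul hC₁.le, ← ofReal_norm]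
        apply ENNReal.ofReal_le_ofReal
        refine le_trans (le_of_eq ?_) (h₁ z hz (ray (FourierTransform.fourier f) ω)
          (ray (FourierTransform.fourier g) ω))
        congr 1
        refine setIntegral_congr_fun measurableSet_Ioi fun r hr => ?_
        have hr' : (0:ℝ) < r := hr
        simp only [ray_apply, finrank_euclideanSpace_fin]
        rw [← ha, norm_smul, norm_eq_of_mem_sphere, mul_one, Real.norm_of_nonneg hr'.le,
          show 2 * (k + 1) - 1 + 1 = 2 * (k + 1) by omega]
        have hne : ((r ^ (2 * (k + 1)) : ℝ) : ℂ) - z ≠ 0 := by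
          have := hdz (r ^ (2 * (k + 1))) (by positivity)
          rw [← norm_pos_iff]; linarith
        have hp : (r ^ (n - 1) : ℝ) = r ^ (n - 1 - 2 * (k + 1) + 1) * r ^ (2 * (k + 1) - 1) := by
          rw [← pow_add]; congr 1; omega
        rw [hp, Complex.real_smul]
        push_cast at hne ⊢
        field_simp
    _ = ENNReal.ofReal C₁ * (∫⁻ ω, ENNReal.ofReal
          (En (n - 1 - 2 * (k + 1)) (ray (FourierTransform.fourier f) ω)) ∂(volume : Measure (Euc n)).toSphere
          + ∫⁻ ω, ENNReal.ofReal (En (n - 1 - 2 * (k + 1)) (ray (FourierTransform.fourier g) ω))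
          ∂(volume : Measure (Euc n)).toSphere) := by
        rw [lintegral_const_mul' _ _ (by simp), lintegral_add_left (En_meas _ _).ennreal_ofReal]
    _ ≤ ENNReal.ofReal C₁ * (ENNReal.ofReal C₂ * X (k + 1) f + ENNReal.ofReal C₂ * X (k + 1) g) := by
        gcongr
        · exact h₂ f
        · exact h₂ g
    _ = _ := by
        rw [ENNReal.ofReal_mul hC₁.le]; ring

lemma X_smul {n : ℕ} (k : ℕ) (c : ℝ) (f : 𝓢(Euc n, ℂ)) :
    X k ((c : ℂ) • f) = ENNReal.ofReal (c ^ 2) * X k f := by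
  unfold X
  rw [← lintegral_const_mul' _ _ (by simp)]
  refine lintegral_congr fun x => ?_
  rw [← ENNReal.ofReal_mul (by positivity), smul_apply, norm_smul, mul_pow]
  congr 1
  simp
  ring

lemma bil_scaled (n m : ℕ) (hm : 1 ≤ m) (hn : 2 * m < n) : ∃ C : ℝ, 0 < C ∧
    ∀ z : ℂ, (z.im ≠ 0 ∨ z.re < 0) → ∀ a f g : 𝓢(Euc n, ℂ),
      (∀ ξ, a ξ * (((‖ξ‖ ^ (2 * m) : ℝ) : ℂ) - z) = FourierTransform.fourier f ξ) →
      ∀ t : ℝ, 0 < t →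
      ‖∫ ξ, a ξ * conj (FourierTransform.fourier g ξ)‖ₑ
        ≤ ENNReal.ofReal C * (ENNReal.ofReal (t⁻¹ ^ 2) * X m f + ENNReal.ofReal (t ^ 2) * X m g) := by
  obtain ⟨C, hC, h⟩ := bil n m hm hn
  refine ⟨C, hC, fun z hz a f g ha t ht => ?_⟩
  have := h z hz (((t⁻¹ : ℝ) : ℂ) • a) (((t⁻¹ : ℝ) : ℂ) • f) ((t : ℂ) • g) (fun ξ => by
    rw [FourierTransform.fourier_smul, smul_apply, smul_apply, ← ha]
    simp only [smul_eq_mul]; ring)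
  rw [X_smul, X_smul] at this
  refine le_trans (le_of_eq ?_) this
  congr 2
  ext ξ
  rw [FourierTransform.fourier_smul, smul_apply, smul_apply]
  have : (t : ℂ) ≠ 0 := by exact_mod_cast ht.ne'
  simp only [smul_eq_mul, map_mul, Complex.conj_ofReal]
  push_cast
  field_simp

open Laplacian in
lemma negLap_sz {n : ℕ} (u : 𝓢(Euc n, ℂ)) :
    ∃ v : 𝓢(Euc n, ℂ), ⇑v = negLap ⇑u ∧ ∀ ξ, FourierTransform.fourier v ξ
      = (((2 * π) ^ 2 * ‖ξ‖ ^ 2 : ℝ) : ℂ) * FourierTransform.fourier u ξ := by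
  refine ⟨-(Δ u), ?_, fun ξ => ?_⟩
  · ext x
    change -(Δ u) x = _
    rw [SchwartzMap.laplacian_apply,
      InnerProductSpace.laplacian_eq_iteratedFDeriv_orthonormalBasis _
        (EuclideanSpace.basisFun (Fin n) ℝ)]
    simp [negLap]
  · have hT : (fun x : Euc n => ‖x‖ ^ 2).HasTemperateGrowth := by fun_prop
    have h : -(Δ u) = ((((2 * π) ^ 2 : ℝ)) : ℂ) • SchwartzMap.fourierMultiplierCLM ℂ
        (fun x : Euc n => ‖x‖ ^ 2) u := by
      rw [SchwartzMap.laplacian_eq_fourierMultiplierCLM]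
      ext x
      simp only [neg_apply, smul_apply, neg_smul, neg_neg, Complex.real_smul, smul_eq_mul]
    rw [h, FourierTransform.fourier_smul, SchwartzMap.fourierMultiplierCLM_apply,
      FourierTransform.fourier_fourierInv_eq, smul_apply,
      SchwartzMap.smulLeftCLM_apply_apply hT, Complex.real_smul, smul_eq_mul]
    push_cast
    ring

lemma negLap_iter {n : ℕ} (u : 𝓢(Euc n, ℂ)) (m : ℕ) :
    ∃ v : 𝓢(Euc n, ℂ), ⇑v = negLap^[m] ⇑u ∧ ∀ ξ, FourierTransform.fourier v ξ
      = (((2 * π) ^ (2 * m) * ‖ξ‖ ^ (2 * m) : ℝ) : ℂ) * FourierTransform.fourier u ξ := by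
  induction m with
  | zero => exact ⟨u, rfl, fun ξ => by simp⟩
  | succ m ih =>
    obtain ⟨v, hv, hv2⟩ := ih
    obtain ⟨w, hw, hw2⟩ := negLap_sz v
    refine ⟨w, by rw [hw, hv, Function.iterate_succ_apply'], fun ξ => ?_⟩
    rw [hw2, hv2]
    push_cast
    ring

lemma wt_le {n m : ℕ} {s : ℝ} (hs : (m : ℝ) < s) (x : Euc n) :
    ‖x‖ ^ (2 * m) ≤ (1 + ‖x‖ ^ 2) ^ s := by
  calc ‖x‖ ^ (2 * m) = (‖x‖ ^ 2) ^ m := by rw [pow_mul]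
    _ ≤ (1 + ‖x‖ ^ 2) ^ m := by gcongr; linarith
    _ = (1 + ‖x‖ ^ 2) ^ (m : ℝ) := (Real.rpow_natCast _ _).symm
    _ ≤ _ := Real.rpow_le_rpow_of_exponent_le (by nlinarith [sq_nonneg ‖x‖]) hs.le

lemma eLp_sq {n : ℕ} (f : Euc n → ℂ) :
    eLpNorm f 2 volume ^ 2 = ∫⁻ x, ENNReal.ofReal (‖f x‖ ^ 2) := by
  rw [eLpNorm_eq_lintegral_rpow_enorm_toReal (by norm_num) (by norm_num), ← ENNReal.rpow_natCast,
    ← ENNReal.rpow_mul]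
  simp only [ENNReal.toReal_ofNat, Nat.cast_ofNat, ne_eq, OfNat.ofNat_ne_zero, not_false_eq_true,
    div_mul_cancel₀, ENNReal.rpow_one]
  refine lintegral_congr fun x => ?_
  rw [ENNReal.ofReal_pow (norm_nonneg _), ofReal_norm]
  norm_cast

lemma wt_sq {n : ℕ} (s : ℝ) (x : Euc n) (c : ℂ) :
    ‖((1 + ‖x‖ ^ 2) ^ (s / 2) : ℝ) • c‖ ^ 2 = (1 + ‖x‖ ^ 2) ^ s * ‖c‖ ^ 2 := by
  have h : (0:ℝ) < 1 + ‖x‖ ^ 2 := by positivity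
  rw [norm_smul, mul_pow, Real.norm_of_nonneg (Real.rpow_nonneg h.le _), ← Real.rpow_natCast,
    ← Real.rpow_mul h.le]
  congr 2
  push_cast
  ring

lemma pairing {n : ℕ} (s : ℝ) (u g : 𝓢(Euc n, ℂ))
    (hg : ∀ x, g x = ((1 + ‖x‖ ^ 2) ^ (-s) : ℝ) • u x) :
    ‖∫ ξ, FourierTransform.fourier u ξ * conj (FourierTransform.fourier g ξ)‖ₑ
      = ∫⁻ x, ENNReal.ofReal ((1 + ‖x‖ ^ 2) ^ (-s) * ‖u x‖ ^ 2) := by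
  have h := SchwartzMap.integral_inner_fourier_fourier g u
  simp only [RCLike.inner_apply] at h
  have h2 : ∀ x, u x * conj (g x) = (((1 + ‖x‖ ^ 2) ^ (-s) * ‖u x‖ ^ 2 : ℝ) : ℂ) := by
    intro x
    rw [hg, Complex.real_smul, map_mul, Complex.conj_ofReal, mul_left_comm, Complex.mul_conj']
    push_cast
    rfl
  have hi := sz_mul_conj_int u g
  simp only [h2] at hi h
  rw [h, integral_complex_ofReal, ← ofReal_norm, Complex.norm_real, Real.norm_of_nonneg,
    ofReal_integral_eq_lintegral_ofReal]
  · have h3 := hi.re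
    simp only [RCLike.re_to_complex, Complex.ofReal_re] at h3
    exact h3
  · exact .of_forall fun x => by positivity
  · exact integral_nonneg fun x => by positivity

lemma fin_alg {A B : ℝ≥0∞} (hA : A ≠ ∞) {C : ℝ} (hC : 0 < C)
    (h : ∀ t : ℝ, 0 < t → A ≤ ENNReal.ofReal C *
      (ENNReal.ofReal (t⁻¹ ^ 2) * B + ENNReal.ofReal (t ^ 2) * A)) :
    A ≤ ENNReal.ofReal ((2 * C) ^ 2) * B := by
  by_cases hB : B = ∞
  · rw [hB, ENNReal.mul_top (by simpa using by positivity)]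
    exact le_top
  lift A to NNReal using hA
  lift B to NNReal using hB
  have ht : 0 < √(1 / (2 * C)) := by positivity
  have hts : √(1 / (2 * C)) ^ 2 = 1 / (2 * C) := Real.sq_sqrt (by positivity)
  have := h _ ht
  rw [inv_pow, hts] at this
  have hA' : (A : ℝ≥0∞) = ENNReal.ofReal (A : ℝ) := (ENNReal.ofReal_coe_nnreal).symm
  have hB' : (B : ℝ≥0∞) = ENNReal.ofReal (B : ℝ) := (ENNReal.ofReal_coe_nnreal).symm
  rw [hA', hB'] at this ⊢
  rw [← ENNReal.ofReal_mul (by positivity), ← ENNReal.ofReal_mul (by positivity),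
    ← ENNReal.ofReal_add (by positivity) (by positivity), ← ENNReal.ofReal_mul (by positivity),
    ENNReal.ofReal_le_ofReal_iff (by positivity)] at this
  rw [← ENNReal.ofReal_mul (by positivity)]
  apply ENNReal.ofReal_le_ofReal
  have e : C * ((1 / (2 * C))⁻¹ * (B : ℝ) + 1 / (2 * C) * A) = 2 * C ^ 2 * B + A / 2 := by
    field_simp
  rw [e] at this
  nlinarith

/-- Uniform weighted resolvent bound near and away from thresholds: for `s > m`,
`‖⟨x⟩^{-s} u‖_{L²} ≤ C ‖⟨x⟩^{s} ((-Δ)^m u - z u)‖_{L²}` uniformly in `z ∈ ℂ \ [0, ∞)`,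
for Schwartz `u`; i.e. `sup_{z ∈ ℂ \ [0,∞)} ‖R₀(z)‖_{L²_s → L²_{-s}} < ∞`. -/
theorem stmt_3 (n m : ℕ) (hm : 2 ≤ m) (hn : 2 * m < n) (s : ℝ) (hs : (m : ℝ) < s) :
    ∃ C : ℝ, 0 < C ∧ ∀ z : ℂ, (z.im ≠ 0 ∨ z.re < 0) → ∀ u : SchwartzMap (Euc n) ℂ,
      eLpNorm (fun x : Euc n => ((1 + ‖x‖ ^ 2) ^ (-s / 2) : ℝ) • u x) 2 volume
        ≤ ENNReal.ofReal C *
          eLpNorm (fun x : Euc n => ((1 + ‖x‖ ^ 2) ^ (s / 2) : ℝ) •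
            ((negLap^[m] ⇑u) x - z * u x)) 2 volume := by
  obtain ⟨C₀, hC₀, hbil⟩ := bil_scaled n m (by omega) hn
  set L : ℝ := (2 * π) ^ (2 * m) with hL
  have hLpos : 0 < L := by positivity
  set C : ℝ := L⁻¹ * C₀ with hCdef
  have hC : 0 < C := by positivity
  refine ⟨2 * C, by positivity, fun z hz u => ?_⟩
  obtain ⟨v, hv, hvF⟩ := negLap_iter u m
  rw [← ENNReal.pow_le_pow_left_iff (two_ne_zero), mul_pow, eLp_sq, eLp_sq,
    ← ENNReal.ofReal_pow (by positivity)]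
  simp only [wt_sq]
  have hT : ∀ r : ℝ, (fun x : Euc n => (1 + ‖x‖ ^ 2) ^ r).HasTemperateGrowth := fun r =>
    Function.hasTemperateGrowth_one_add_norm_sq_rpow (Euc n) r
  set g : 𝓢(Euc n, ℂ) := SchwartzMap.smulLeftCLM ℂ (fun x : Euc n => (1 + ‖x‖ ^ 2) ^ (-s)) u
  have hg : ∀ x, g x = ((1 + ‖x‖ ^ 2) ^ (-s) : ℝ) • u x := fun x =>
    SchwartzMap.smulLeftCLM_apply_apply (hT _) u x
  have hpair := pairing s u g hg
  set f : 𝓢(Euc n, ℂ) := v - z • u with hf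
  have hfx : ∀ x, f x = (negLap^[m] ⇑u) x - z * u x := fun x => by
    rw [hf, ← hv]; simp
  have hfF : ∀ ξ, FourierTransform.fourier f ξ
      = ((L * ‖ξ‖ ^ (2 * m) : ℝ) : ℂ) * FourierTransform.fourier u ξ
        - z * FourierTransform.fourier u ξ := fun ξ => by
    have : FourierTransform.fourier f = FourierTransform.fourier v
        - z • FourierTransform.fourier u := by
      rw [hf, sub_eq_add_neg, ← neg_smul, FourierTransform.fourier_add,
        FourierTransform.fourier_smul, neg_smul, ← sub_eq_add_neg]
    rw [this, ← hvF]
    simp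
  simp only [← hfx]
  have hz' : (z / (L : ℂ)).im ≠ 0 ∨ (z / (L : ℂ)).re < 0 := by
    rw [Complex.div_ofReal_im, Complex.div_ofReal_re]
    rcases hz with h | h
    · left; exact div_ne_zero h hLpos.ne'
    · right; exact div_neg_of_neg_of_pos h hLpos
  have hLC : (L : ℂ) ≠ 0 := by exact_mod_cast hLpos.ne'
  have hb := hbil (z / L) hz' ((L : ℂ) • FourierTransform.fourier u) f g (fun ξ => by
    rw [hfF, smul_apply, smul_eq_mul]
    push_cast
    field_simp)
  have hint : ∫ ξ, ((L : ℂ) • FourierTransform.fourier u) ξ * conj (FourierTransform.fourier g ξ)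
      = L * ∫ ξ, FourierTransform.fourier u ξ * conj (FourierTransform.fourier g ξ) := by
    rw [← integral_const_mul]
    refine integral_congr_ae (.of_forall fun ξ => ?_)
    simp only [smul_apply, smul_eq_mul, mul_assoc]
  rw [hint, enorm_mul, hpair] at hb
  have hLe : ‖(L : ℂ)‖ₑ = ENNReal.ofReal L := by
    rw [← ofReal_norm, Complex.norm_real, Real.norm_of_nonneg hLpos.le]
  rw [hLe] at hb
  have hXf : X m f ≤ ∫⁻ x, ENNReal.ofReal ((1 + ‖x‖ ^ 2) ^ s * ‖f x‖ ^ 2) := by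
    refine lintegral_mono fun x => ENNReal.ofReal_le_ofReal ?_
    gcongr
    exact wt_le hs x
  have hXg : X m g ≤ ∫⁻ x, ENNReal.ofReal ((1 + ‖x‖ ^ 2) ^ (-s) * ‖u x‖ ^ 2) := by
    refine lintegral_mono fun x => ENNReal.ofReal_le_ofReal ?_
    have hp : (0:ℝ) < 1 + ‖x‖ ^ 2 := by positivity
    rw [hg, norm_smul, Real.norm_of_nonneg (Real.rpow_nonneg hp.le _)]
    calc ‖x‖ ^ (2 * m) * ((1 + ‖x‖ ^ 2) ^ (-s) * ‖u x‖) ^ 2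
        ≤ (1 + ‖x‖ ^ 2) ^ s * ((1 + ‖x‖ ^ 2) ^ (-s) * ‖u x‖) ^ 2 := by
          gcongr
          exact wt_le hs x
      _ = ((1 + ‖x‖ ^ 2) ^ s * (1 + ‖x‖ ^ 2) ^ (-s)) * ((1 + ‖x‖ ^ 2) ^ (-s) * ‖u x‖ ^ 2) := by ring
      _ = _ := by rw [← Real.rpow_add hp, add_neg_cancel, Real.rpow_zero, one_mul]
  apply fin_alg _ hC
  · intro t ht
    have h1 := mul_le_mul_right (hb t ht) (ENNReal.ofReal L⁻¹)
    rw [← mul_assoc, ← ENNReal.ofReal_mul (by positivity), inv_mul_cancel₀ hLpos.ne',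
      ENNReal.ofReal_one, one_mul, ← mul_assoc, ← ENNReal.ofReal_mul (by positivity)] at h1
    refine h1.trans ?_
    gcongr
  · rw [← hpair]
    exact enorm_ne_top
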